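/- Let m ≥ 4, let ℱ_m = {B_{m,m}, V_m, Λ_m}, and let G be an ℱ_m-saturated graph. Let B be the set of all vertices of G that lie in some copy of K_m in G. Then the subgraph of G induced by B is a disjoint union of copies of K_m. -/

import Mathlib

open SimpleGraph Finset

variable {V : Type*}

/-- The graph `G` with the edge `u v` added. -/
def addEdge (G : SimpleGraph V) (u v : V) : SimpleGraph V :=
  G ⊔ SimpleGraph.fromEdgeSet {s(u, v)}

/-- `G` is `K_s`-saturated: `G` is `K_s`-free and adding any missing edge creates a `K_s`. -/
def KSat (s : ℕ) (G : SimpleGraph V) : Prop :=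
  G.CliqueFree s ∧ ∀ u v : V, u ≠ v → ¬ G.Adj u v → ¬ (addEdge G u v).CliqueFree s

/-- The number of copies of `K_r` in `G`: the number of `r`-sets of vertices inducing
a complete graph. -/
noncomputable def cliqueCount (G : SimpleGraph V) (r : ℕ) : ℕ :=
  {t : Finset V | G.IsNClique r t}.ncard

/-- `sat(n, K_r, K_s)`: minimum number of copies of `K_r` in an `n`-vertex
`K_s`-saturated graph. -/
noncomputable def satCliques (n r s : ℕ) : ℕ :=
  sInf {m | ∃ G : SimpleGraph (Fin n), KSat s G ∧ cliqueCount G r = m}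

/-- The join `K_{s-2} ∗ ∅_{n-s+2}` on `Fin n`. -/
def joinGraph (n s : ℕ) : SimpleGraph (Fin n) :=
  SimpleGraph.fromRel (fun i _ => (i : ℕ) < s - 2)

/-- The number of copies of `C_r` in `G` : the number of subgraphs of `G`
isomorphic to the cycle on `r` vertices. -/
noncomputable def cycleCount (G : SimpleGraph V) (r : ℕ) : ℕ :=
  {H : G.Subgraph | Nonempty (H.coe ≃g cycleGraph r)}.ncard

/-- `sat(n, C_r, K_s)`. -/
noncomputable def satCyclesCliqueSat (n r s : ℕ) : ℕ :=
  sInf {m | ∃ G : SimpleGraph (Fin n), KSat s G ∧ cycleCount G r = m}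

/-- `G` contains a copy of `F`, i.e. a subgraph isomorphic to `F`. -/
def ContainsCopy {α β : Type*} (F : SimpleGraph α) (G : SimpleGraph β) : Prop :=
  ∃ f : α → β, Function.Injective f ∧ ∀ a b : α, F.Adj a b → G.Adj (f a) (f b)

/-- strongly K_s-saturated -/
def StronglyKSat (s : ℕ) (G : SimpleGraph V) : Prop :=
  ∀ u v : V, u ≠ v → ¬ G.Adj u v →
    ∃ t : Finset V, (addEdge G u v).IsNClique s t ∧ u ∈ t ∧ v ∈ t

/-- dumbbell -/
def dumbbell (m : ℕ) : SimpleGraph (Fin (2 * m)) :=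
  SimpleGraph.fromRel (fun i j =>
    ((i : ℕ) < m ∧ (j : ℕ) < m) ∨ (m ≤ (i : ℕ) ∧ m ≤ (j : ℕ)) ∨ ((i : ℕ) = 0 ∧ (j : ℕ) = m))

def Vgraph (m : ℕ) : SimpleGraph (Fin (m + 2)) :=
  SimpleGraph.fromRel (fun i j =>
    ((i : ℕ) < m ∧ (j : ℕ) < m) ∨ ((i : ℕ) = 0 ∧ m ≤ (j : ℕ)))

def lambdaGraph (m : ℕ) : SimpleGraph (Fin (m + 1)) :=
  SimpleGraph.fromRel (fun i j =>
    ((i : ℕ) < m ∧ (j : ℕ) < m) ∨ ((i : ℕ) = m ∧ (j : ℕ) < 2))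

def VgraphGen (m r : ℕ) : SimpleGraph (Fin (m + (m - r))) :=
  SimpleGraph.fromRel (fun i j =>
    ((i : ℕ) < m ∧ (j : ℕ) < m) ∨
      (((i : ℕ) = 0 ∨ m ≤ (i : ℕ)) ∧ ((j : ℕ) = 0 ∨ m ≤ (j : ℕ))))

def lambdaGraphGen (m r : ℕ) : SimpleGraph (Fin (m + 1)) :=
  SimpleGraph.fromRel (fun i j =>
    ((i : ℕ) < m ∧ (j : ℕ) < m) ∨ ((i : ℕ) = m ∧ (j : ℕ) < r))

/-- `G` is saturated with respect to the family `{F₁, F₂, F₃}`. -/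
def FamSat3 {α₁ α₂ α₃ : Type*} (F₁ : SimpleGraph α₁) (F₂ : SimpleGraph α₂)
    (F₃ : SimpleGraph α₃) (G : SimpleGraph V) : Prop :=
  ¬ ContainsCopy F₁ G ∧ ¬ ContainsCopy F₂ G ∧ ¬ ContainsCopy F₃ G ∧
    ∀ u v : V, u ≠ v → ¬ G.Adj u v →
      ContainsCopy F₁ (addEdge G u v) ∨ ContainsCopy F₂ (addEdge G u v) ∨
        ContainsCopy F₃ (addEdge G u v)

noncomputable def satFam3 {α₁ α₂ α₃ : Type*} (n : ℕ) (F₁ : SimpleGraph α₁)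
    (F₂ : SimpleGraph α₂) (F₃ : SimpleGraph α₃) : ℕ :=
  sInf {m | ∃ G : SimpleGraph (Fin n), FamSat3 F₁ F₂ F₃ G ∧ G.edgeSet.ncard = m}

noncomputable def satCliquesFam3 {α₁ α₂ α₃ : Type*} (n r : ℕ) (F₁ : SimpleGraph α₁)
    (F₂ : SimpleGraph α₂) (F₃ : SimpleGraph α₃) : ℕ :=
  sInf {m | ∃ G : SimpleGraph (Fin n), FamSat3 F₁ F₂ F₃ G ∧ cliqueCount G r = m}

/-- saturation w.r.t. a single graph, with copies as subgraphs. -/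
def SatGraph {α : Type*} (F : SimpleGraph α) (G : SimpleGraph V) : Prop :=
  ¬ ContainsCopy F G ∧ ∀ u v : V, u ≠ v → ¬ G.Adj u v → ContainsCopy F (addEdge G u v)

noncomputable def satCyclesGraphSat {α : Type*} (n r : ℕ) (F : SimpleGraph α) : ℕ :=
  sInf {m | ∃ G : SimpleGraph (Fin n), SatGraph F G ∧ cycleCount G r = m}

/-- number of independent sets of size l -/
noncomputable def indepCount (G : SimpleGraph V) (l : ℕ) : ℕ :=
  {t : Finset V | t.card = l ∧ ∀ a ∈ t, ∀ b ∈ t, ¬ G.Adj a b}.ncard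

/-- Ramsey number -/
noncomputable def ramsey (l s : ℕ) : ℕ :=
  sInf {N | ∀ G : SimpleGraph (Fin N),
    (∃ t : Finset (Fin N), t.card = l ∧ ∀ a ∈ t, ∀ b ∈ t, ¬ G.Adj a b) ∨
      ∃ t : Finset (Fin N), G.IsNClique s t}

/-- The elements of a finite set can be listed starting with two prescribed ones. -/
theorem Finset.exists_enum_pair {α : Type*} {m : ℕ} {t : Finset α} (ht : t.card = m)
    {a b : α} (ha : a ∈ t) (hb : b ∈ t) (hab : a ≠ b) :
    ∃ e : ℕ → α, (∀ i < m, e i ∈ t) ∧ (∀ i < m, ∀ j < m, e i = e j → i = j) ∧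
      e 0 = a ∧ e 1 = b := by
  classical
  set l := a :: b :: ((t.erase a).erase b).toList with hl
  have hnd : l.Nodup := by simp [hl, hab, Finset.nodup_toList]
  have hmem : ∀ x ∈ l, x ∈ t := by
    intro x hx
    simp only [hl, List.mem_cons, Finset.mem_toList, Finset.mem_erase] at hx
    grind
  have hlen : l.length = m := by
    have h1 := Finset.card_erase_add_one (Finset.mem_erase.2 ⟨hab.symm, hb⟩)
    have h2 := Finset.card_erase_add_one ha
    simp only [hl, List.length_cons, Finset.length_toList]
    omega
  refine ⟨fun i => l.getD i a, fun i hi => ?_, fun i hi j hj hij => ?_, by simp [hl], by simp [hl]⟩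
  · have hi' : i < l.length := by omega
    simpa only [List.getD_eq_getElem _ _ hi'] using hmem _ (List.getElem_mem hi')
  · have hi' : i < l.length := by omega
    have hj' : j < l.length := by omega
    simp only [List.getD_eq_getElem _ _ hi', List.getD_eq_getElem _ _ hj'] at hij
    exact (hnd.getElem_inj_iff).1 hij

/-- The elements of a finite set can be listed starting with a prescribed one. -/
theorem Finset.exists_enum {α : Type*} {m : ℕ} (hm : 2 ≤ m) {t : Finset α} (ht : t.card = m)
    {a : α} (ha : a ∈ t) :
    ∃ e : ℕ → α, (∀ i < m, e i ∈ t) ∧ (∀ i < m, ∀ j < m, e i = e j → i = j) ∧ e 0 = a := by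
  obtain ⟨b, hb, hba⟩ := Finset.exists_mem_ne (by omega : 1 < t.card) a
  obtain ⟨e, h1, h2, h3, -⟩ := Finset.exists_enum_pair ht ha hb hba.symm
  exact ⟨e, h1, h2, h3⟩

/-- An injective map sending `r`-related distinct vertices to adjacent ones is a copy of
`fromRel r`. -/
theorem containsCopy_fromRel {α β : Type*} {r : α → α → Prop} {G : SimpleGraph β} (f : α → β)
    (hf : Function.Injective f) (h : ∀ a b, a ≠ b → r a b → G.Adj (f a) (f b)) :
    ContainsCopy (SimpleGraph.fromRel r) G := by
  refine ⟨f, hf, fun a b hab => ?_⟩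
  rw [SimpleGraph.fromRel_adj] at hab
  rcases hab with ⟨hne, hr | hr⟩
  · exact h a b hne hr
  · exact (h b a hne.symm hr).symm

theorem containsCopy_lambdaGraph {m : ℕ} {V : Type*} {G : SimpleGraph V}
    {t : Finset V} (ht : G.IsNClique m t) {a b x : V} (ha : a ∈ t) (hb : b ∈ t) (hab : a ≠ b)
    (hx : x ∉ t) (hxa : G.Adj x a) (hxb : G.Adj x b) : ContainsCopy (lambdaGraph m) G := by
  obtain ⟨e, he, hinj, h0, h1⟩ := Finset.exists_enum_pair ht.card_eq ha hb hab
  have hm : 1 < m := ht.card_eq ▸ Finset.one_lt_card.2 ⟨a, ha, b, hb, hab⟩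
  refine containsCopy_fromRel (fun i => if (i : ℕ) < m then e i else x) ?_ ?_
  · rintro ⟨i, hi⟩ ⟨j, hj⟩ hij
    grind
  · rintro ⟨i, hi⟩ ⟨j, hj⟩ hne hr
    have hne : i ≠ j := fun h => hne (Fin.ext h)
    dsimp only at hr ⊢
    rcases hr with ⟨hi', hj'⟩ | ⟨rfl, hj'⟩
    · simp only [hi', hj', if_true]
      exact ht.isClique (he i hi') (he j hj') fun h => hne (hinj i hi' j hj' h)
    · rw [if_neg (lt_irrefl _), if_pos (by omega)]
      interval_cases j
      · rwa [h0]
      · rwa [h1]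

theorem containsCopy_Vgraph {m : ℕ} (hm : 2 ≤ m) {V : Type*} {G : SimpleGraph V}
    {t : Finset V} (ht : G.IsNClique m t) {a x y : V} (ha : a ∈ t) (hx : x ∉ t) (hy : y ∉ t)
    (hxy : x ≠ y) (hax : G.Adj a x) (hay : G.Adj a y) : ContainsCopy (Vgraph m) G := by
  obtain ⟨e, he, hinj, h0⟩ := Finset.exists_enum hm ht.card_eq ha
  refine containsCopy_fromRel
    (fun i => if (i : ℕ) < m then e i else if (i : ℕ) = m then x else y) ?_ ?_
  · rintro ⟨i, hi⟩ ⟨j, hj⟩ hij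
    grind
  · rintro ⟨i, hi⟩ ⟨j, hj⟩ hne hr
    have hne : i ≠ j := fun h => hne (Fin.ext h)
    dsimp only at hr ⊢
    rcases hr with ⟨hi', hj'⟩ | ⟨rfl, hj'⟩
    · simp only [hi', hj', if_true]
      exact ht.isClique (he i hi') (he j hj') fun h => hne (hinj i hi' j hj' h)
    · rw [if_pos (by omega), if_neg (by omega), h0]
      split_ifs
      · exact hax
      · exact hay

theorem containsCopy_dumbbell {m : ℕ} (hm : 2 ≤ m) {V : Type*} {G : SimpleGraph V}
    {s t : Finset V} (hs : G.IsNClique m s) (ht : G.IsNClique m t) (hst : Disjoint s t)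
    {a b : V} (ha : a ∈ s) (hb : b ∈ t) (hab : G.Adj a b) : ContainsCopy (dumbbell m) G := by
  obtain ⟨e, he, hinj, h0⟩ := Finset.exists_enum hm hs.card_eq ha
  obtain ⟨e', he', hinj', h0'⟩ := Finset.exists_enum hm ht.card_eq hb
  have hd : ∀ i < m, ∀ j < m, e i ≠ e' j := fun i hi j hj h =>
    Finset.disjoint_left.1 hst (he i hi) (h ▸ he' j hj)
  refine containsCopy_fromRel (fun i => if (i : ℕ) < m then e i else e' (i - m)) ?_ ?_
  · rintro ⟨i, hi⟩ ⟨j, hj⟩ hij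
    simp only [Fin.mk.injEq] at hij ⊢
    split_ifs at hij with h1 h2 h2
    · exact hinj i h1 j h2 hij
    · exact absurd hij (hd i h1 _ (by omega))
    · exact absurd hij.symm (hd j h2 _ (by omega))
    · have := hinj' _ (by omega) _ (by omega) hij
      omega
  · rintro ⟨i, hi⟩ ⟨j, hj⟩ hne hr
    have hne : i ≠ j := fun h => hne (Fin.ext h)
    dsimp only at hr ⊢
    rcases hr with ⟨hi', hj'⟩ | ⟨hi', hj'⟩ | ⟨rfl, rfl⟩
    · simp only [hi', hj', if_true]
      exact hs.isClique (he i hi') (he j hj') fun h => hne (hinj i hi' j hj' h)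
    · rw [if_neg (by omega), if_neg (by omega)]
      refine ht.isClique (he' _ (by omega)) (he' _ (by omega)) fun h => ?_
      have := hinj' _ (by omega) _ (by omega) h
      omega
    · rw [if_pos (by omega), if_neg (lt_irrefl _), Nat.sub_self, h0, h0']
      exact hab

/-- In a graph without copies of `V_m` and `Λ_m`, distinct copies of `K_m` are disjoint. -/
theorem disjoint_of_isNClique_of_ne {m : ℕ} (hm : 3 ≤ m) {V : Type*} {G : SimpleGraph V}
    (hV : ¬ ContainsCopy (Vgraph m) G) (hL : ¬ ContainsCopy (lambdaGraph m) G)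
    {s t : Finset V} (hs : G.IsNClique m s) (ht : G.IsNClique m t) (hst : s ≠ t) :
    Disjoint s t := by
  classical
  rw [Finset.disjoint_left]
  intro v hvs hvt
  by_cases h : ∃ w ∈ s, w ∈ t ∧ w ≠ v
  · obtain ⟨w, hws, hwt, hwv⟩ := h
    obtain ⟨x, hxt, hxs⟩ : ∃ x ∈ t, x ∉ s := by
      by_contra! hsub
      exact hst (Finset.eq_of_subset_of_card_le hsub
        (by rw [hs.card_eq, ht.card_eq])).symm
    exact hL (containsCopy_lambdaGraph hs hvs hws hwv.symm hxs
      (ht.isClique hxt hvt fun h => hxs (h ▸ hvs)) (ht.isClique hxt hwt fun h => hxs (h ▸ hws)))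
  · push Not at h
    have hcard : 1 < (t.erase v).card := by
      have := Finset.card_erase_add_one hvt
      have := ht.card_eq
      omega
    obtain ⟨x, hx, y, hy, hxy⟩ := Finset.one_lt_card.1 hcard
    rw [Finset.mem_erase] at hx hy
    exact hV (containsCopy_Vgraph (by omega) hs hvs (fun hxs => hx.1 (h x hxs hx.2))
      (fun hys => hy.1 (h y hys hy.2)) hxy (ht.isClique hvt hx.2 hx.1.symm)
      (ht.isClique hvt hy.2 hy.1.symm))

/-- Let `m ≥ 4`, `ℱ_m = {B_{m,m}, V_m, Λ_m}`, and let `G` be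
`ℱ_m`-saturated. Let `B` be the set of vertices lying in some copy of `K_m`. Then the subgraph
induced by `B` is a disjoint union of copies of `K_m`. -/
theorem induced_subgraph_on_B (m : ℕ) (hm : 4 ≤ m) {V : Type*} (G : SimpleGraph V)
    (hG : FamSat3 (dumbbell m) (Vgraph m) (lambdaGraph m) G) :
    ∃ P : Set (Finset V),
      (∀ t ∈ P, G.IsNClique m t) ∧
      ({v : V | ∃ t : Finset V, G.IsNClique m t ∧ v ∈ t} = ⋃ t ∈ P, (t : Set V)) ∧
      (∀ t ∈ P, ∀ t' ∈ P, t ≠ t' → Disjoint t t') ∧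
      (∀ u v : V, (∃ t : Finset V, G.IsNClique m t ∧ u ∈ t) →
        (∃ t : Finset V, G.IsNClique m t ∧ v ∈ t) →
        G.Adj u v → ∃ t ∈ P, u ∈ t ∧ v ∈ t) := by
  obtain ⟨hD, hV, hL, -⟩ := hG
  have hdisj : ∀ s t : Finset V, G.IsNClique m s → G.IsNClique m t → s ≠ t → Disjoint s t :=
    fun s t hs ht => disjoint_of_isNClique_of_ne (by omega) hV hL hs ht
  refine ⟨{t | G.IsNClique m t}, fun t ht => ht, ?_, fun t ht t' ht' => hdisj t t' ht ht', ?_⟩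
  · ext v
    simp
  · rintro u v ⟨s, hs, hus⟩ ⟨t, ht, hvt⟩ huv
    by_cases hst : s = t
    · exact ⟨s, hs, hus, hst ▸ hvt⟩
    · exact absurd (containsCopy_dumbbell (by omega) hs ht (hdisj s t hs ht hst) hus hvt huv) hD
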